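/- arXiv:1903.03296 — 8 statements merged into one kernel-verified Lean document; each statement's English description precedes it below -/
import Mathlib

section
/- Let f, g : (0, ∞) → ℝ be continuous functions with f(x) > 0 and g(x) > 0 for all x > 0, and suppose the ratio x ↦ f(x)/g(x) is decreasing (antitone) on (0, ∞). Define H(x) = (∫₀ˣ f(t) dt) / (∫₀ˣ g(t) dt) for x > 0. Then H is decreasing (antitone) on (0, ∞); that is, for all 0 < x₁ < x₂, H(x₂) ≤ H(x₁). -/
/-- If `f, g` are continuous, positive functions on `(0, ∞)` (continuous up to `0`
so integrals are finite), and the ratio `f/g` is antitone on `(0, ∞)`, then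
`H x = (∫₀ˣ f) / (∫₀ˣ g)` is antitone on `(0, ∞)`. -/
theorem antitoneOn_integral_ratio (f g : ℝ → ℝ)
    (hf : ContinuousOn f (Set.Ici 0)) (hg : ContinuousOn g (Set.Ici 0))
    (hfpos : ∀ x > (0 : ℝ), 0 < f x) (hgpos : ∀ x > (0 : ℝ), 0 < g x)
    (hratio : AntitoneOn (fun x => f x / g x) (Set.Ioi 0)) :
    AntitoneOn (fun x => (∫ t in (0 : ℝ)..x, f t) / ∫ t in (0 : ℝ)..x, g t)
      (Set.Ioi 0) := by
  intro x (hx : 0 < x) y (hy : 0 < y) hxy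
  have integrable : ∀ {h : ℝ → ℝ}, ContinuousOn h (Set.Ici 0) → ∀ {a b : ℝ}, 0 ≤ a → a ≤ b →
      IntervalIntegrable h MeasureTheory.volume a b := fun hh _ _ ha hab =>
    (hh.mono fun t ht => ha.trans ht.1).intervalIntegrable_of_Icc hab
  have hfx := integrable hf le_rfl hx.le
  have hgx := integrable hg le_rfl hx.le
  have hfxy := integrable hf hx.le hxy
  have hgxy := integrable hg hx.le hxy
  have hGx : 0 < ∫ t in (0 : ℝ)..x, g t :=
    intervalIntegral.intervalIntegral_pos_of_pos_on hgx (fun t ht => hgpos t ht.1) hx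
  have hGy : 0 < ∫ t in (0 : ℝ)..y, g t :=
    intervalIntegral.intervalIntegral_pos_of_pos_on (integrable hg le_rfl hy.le)
      (fun t ht => hgpos t ht.1) hy
  have hB : 0 ≤ ∫ t in x..y, g t :=
    intervalIntegral.integral_nonneg hxy fun t ht => (hgpos t (hx.trans_le ht.1)).le
  have left : f x / g x * (∫ t in (0 : ℝ)..x, g t) ≤ ∫ t in (0 : ℝ)..x, f t := by
    rw [← intervalIntegral.integral_const_mul]
    refine intervalIntegral.integral_mono_on_of_le_Ioo hx.le (hgx.const_mul _) hfx fun t ht => ?_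
    exact (le_div_iff₀ (hgpos t ht.1)).1 (hratio ht.1 hx ht.2.le)
  have right : (∫ t in x..y, f t) ≤ f x / g x * ∫ t in x..y, g t := by
    rw [← intervalIntegral.integral_const_mul]
    refine intervalIntegral.integral_mono_on hxy hfxy (hgxy.const_mul _) fun t ht => ?_
    have ht0 : 0 < t := hx.trans_le ht.1
    exact (div_le_iff₀ (hgpos t ht0)).1 (hratio hx ht0 ht.1)
  change (∫ t in (0 : ℝ)..y, f t) / (∫ t in (0 : ℝ)..y, g t) ≤
    (∫ t in (0 : ℝ)..x, f t) / ∫ t in (0 : ℝ)..x, g t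
  rw [div_le_div_iff₀ hGy hGx, ← intervalIntegral.integral_add_adjacent_intervals hfx hfxy,
    ← intervalIntegral.integral_add_adjacent_intervals hgx hgxy]
  linear_combination (∫ t in (0 : ℝ)..x, g t) * right + (∫ t in x..y, g t) * left
end

section
/- The function g₁(x) = (1 − (1 − e^{−x})/x)/x is decreasing (antitone) on (0, ∞). -/
/-- The Padé-type bound `(2 - x) ≤ (x + 2) e^{-x}` for `x ≥ 0`. -/
theorem two_sub_le_add_two_mul_exp_neg {x : ℝ} (hx : 0 ≤ x) :
    2 - x ≤ (x + 2) * Real.exp (-x) := by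
  have hderiv (y : ℝ) : HasDerivAt (fun t : ℝ => (t + 2) * Real.exp (-t) + t)
      (1 - (y + 1) * Real.exp (-y)) y := by
    refine ((((hasDerivAt_id y).add_const 2).mul (hasDerivAt_id y).neg.exp).add
      (hasDerivAt_id y)).congr_deriv ?_
    simp only [id, Pi.neg_apply]
    ring
  have hmono : Monotone (fun t : ℝ => (t + 2) * Real.exp (-t) + t) := by
    refine monotone_of_hasDerivAt_nonneg hderiv fun y => ?_
    have h := mul_le_mul_of_nonneg_right (Real.add_one_le_exp y) (Real.exp_pos (-y)).le
    rw [← Real.exp_add, add_neg_cancel, Real.exp_zero] at h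
    exact sub_nonneg.2 h
  have h := hmono hx
  simp only [zero_add, neg_zero, Real.exp_zero, mul_one, add_zero] at h
  linarith

/-- The function `g₁(x) = (1 - (1 - e^{-x})/x)/x` is antitone (decreasing) on `(0, ∞)`. -/
theorem antitoneOn_g1 :
    AntitoneOn (fun x : ℝ => (1 - (1 - Real.exp (-x)) / x) / x) (Set.Ioi 0) := by
  have hderiv (x : ℝ) (hx : 0 < x) :
      HasDerivAt (fun x : ℝ => (1 - (1 - Real.exp (-x)) / x) / x)
        ((2 - x - (x + 2) * Real.exp (-x)) / x ^ 3) x := by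
    refine (((((hasDerivAt_id x).neg.exp.const_sub 1).div (hasDerivAt_id x) hx.ne').const_sub
      1).div (hasDerivAt_id x) hx.ne').congr_deriv ?_
    simp only [id, Pi.neg_apply, Pi.div_apply]
    field_simp
    ring
  refine antitoneOn_of_hasDerivWithinAt_nonpos (convex_Ioi 0)
    (fun x hx => (hderiv x hx).continuousAt.continuousWithinAt)
    (fun x hx => (hderiv x (interior_subset hx)).hasDerivWithinAt) fun x hx => ?_
  have hx : 0 < x := interior_subset hx
  exact div_nonpos_of_nonpos_of_nonneg
    (sub_nonpos.2 (two_sub_le_add_two_mul_exp_neg hx.le)) (pow_nonneg hx.le 3)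
end

section
/- The function g₂(x) = (1 − 2(1 − (1 − e^{−x})/x)/x)/x is decreasing (antitone) on (0, ∞). -/
/-- For `x ≠ 0`, the function `g₂` is the Laplace-type integral of `(1 - t)²` over `[0, 1]`. -/
theorem integral_one_sub_sq_mul_exp_neg_mul {x : ℝ} (hx : x ≠ 0) :
    ∫ t in (0 : ℝ)..1, (1 - t) ^ 2 * Real.exp (-(x * t)) =
      (1 - 2 * ((1 - (1 - Real.exp (-x)) / x) / x)) / x := by
  have hderiv (t : ℝ) : HasDerivAt
      (fun t => -(((1 - t) ^ 2 / x - 2 * (1 - t) / x ^ 2 + 2 / x ^ 3) * Real.exp (-(x * t))))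
      ((1 - t) ^ 2 * Real.exp (-(x * t))) t := by
    have hlin : HasDerivAt (fun t : ℝ => 1 - t) (-1) t := (hasDerivAt_id t).const_sub 1
    have hexp : HasDerivAt (fun t : ℝ => Real.exp (-(x * t)))
        (Real.exp (-(x * t)) * -(x * 1)) t := ((hasDerivAt_id t).const_mul x).neg.exp
    have hpoly := (((hlin.pow 2).div_const x).sub ((hlin.const_mul 2).div_const (x ^ 2))).add_const
      (2 / x ^ 3)
    refine (hpoly.mul hexp).neg.congr_deriv ?_
    simp only [Pi.sub_apply, Pi.pow_apply]
    field_simp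
    ring
  rw [intervalIntegral.integral_eq_sub_of_hasDerivAt (fun t _ => hderiv t)
    (Continuous.intervalIntegrable (by fun_prop) _ _)]
  simp only [mul_one, mul_zero, neg_zero, Real.exp_zero]
  field_simp
  ring

/-- The function `g₂(x) = (1 - 2(1 - (1 - e^{-x})/x)/x)/x` is antitone (decreasing)
on `(0, ∞)`. -/
theorem antitoneOn_g2 :
    AntitoneOn (fun x : ℝ => (1 - 2 * ((1 - (1 - Real.exp (-x)) / x) / x)) / x)
      (Set.Ioi 0) := by
  intro x hx y hy hxy
  simp only
  rw [← integral_one_sub_sq_mul_exp_neg_mul (ne_of_gt hx),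
    ← integral_one_sub_sq_mul_exp_neg_mul (ne_of_gt hy)]
  refine intervalIntegral.integral_mono_on zero_le_one
    (Continuous.intervalIntegrable (by fun_prop) _ _)
    (Continuous.intervalIntegrable (by fun_prop) _ _) fun t ht => ?_
  have := ht.1
  gcongr
end

section
/- For every x > 0 one has g₁(x)/g₀(x) ≤ 1/(1 − e^{−2}). -/
/-- For every `x > 0`, `g₁(x)/g₀(x) ≤ 1/(1 - e^{-2})`, where
`g₀(x) = (1 - e^{-x})/x` and `g₁(x) = (1 - g₀(x))/x`. -/
theorem g1_div_g0_bound (x : ℝ) (hx : 0 < x) :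
    ((1 - (1 - Real.exp (-x)) / x) / x) / ((1 - Real.exp (-x)) / x)
      ≤ 1 / (1 - Real.exp (-2)) := by
  have h_neg : Real.exp (-x) < 1 := Real.exp_lt_one_iff.2 (by linarith)
  have h_two : Real.exp (-2) < 1 := Real.exp_lt_one_iff.2 (by norm_num)
  have h_mul : Real.exp (-x) * Real.exp x = 1 := by rw [← Real.exp_add]; simp
  have h_exp : Real.exp (-x) ≤ (1 - Real.exp (-x)) / x := by
    rw [le_div_iff₀ hx]
    nlinarith [mul_le_mul_of_nonneg_left (Real.add_one_le_exp x) (Real.exp_pos (-x)).le]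
  calc ((1 - (1 - Real.exp (-x)) / x) / x) / ((1 - Real.exp (-x)) / x)
      = (1 - (1 - Real.exp (-x)) / x) / (1 - Real.exp (-x)) :=
        div_div_div_cancel_right₀ hx.ne' _ _
    _ ≤ 1 := (div_le_one (by linarith)).2 (by linarith)
    _ ≤ 1 / (1 - Real.exp (-2)) :=
        (one_le_div (by linarith)).2 (by linarith [Real.exp_pos (-2)])
end

section
/- For every x > 0 one has g₂(x)/g₀(x) ≤ 1/(1 − e^{−2}). -/
theorem exp_neg_mul_two_sub_sq_ge {x : ℝ} (hx : 0 < x) :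
    2 - 2 * x ≤ Real.exp (-x) * (2 - x ^ 2) := by
  rcases le_total x 1 with h1 | h1
  · have hb := Real.exp_bound (x := -x) (by rw [abs_neg, abs_of_pos hx]; exact h1)
      (n := 4) (by norm_num)
    rw [abs_neg, abs_of_pos hx] at hb
    have hl := (abs_le.mp hb).1
    norm_num [Finset.sum_range_succ, Nat.factorial] at hl
    have he : 1 - x + x ^ 2 / 2 - x ^ 3 / 6 - 5 * x ^ 4 / 96 ≤ Real.exp (-x) := by
      linarith
    have hm := mul_le_mul_of_nonneg_right he (show 0 ≤ 2 - x ^ 2 by nlinarith)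
    have h3 : 0 ≤ x ^ 3 * (1 - x) := mul_nonneg (by positivity) (by linarith)
    have h5 : 0 < x ^ 5 := by positivity
    have h6 : 0 < x ^ 6 := by positivity
    have h3' : 0 < x ^ 3 := by positivity
    linarith
  · have hp := Real.exp_pos (-x)
    have he : Real.exp (-x) * (1 + x) ≤ 1 := by
      have hm := mul_le_mul_of_nonneg_left (Real.add_one_le_exp x) hp.le
      rw [← Real.exp_add, neg_add_cancel, Real.exp_zero] at hm
      linarith
    nlinarith [mul_nonneg hp.le (sq_nonneg x), mul_le_mul_of_nonneg_right he (sub_nonneg.mpr h1)]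

/-- For every `x > 0`, `g₂(x)/g₀(x) ≤ 1/(1 - e^{-2})`, where
`g₀(x) = (1 - e^{-x})/x` and `g₂(x) = (1 - 2(1 - g₀(x))/x)/x`. -/
theorem g2_div_g0_bound (x : ℝ) (hx : 0 < x) :
    ((1 - 2 * ((1 - (1 - Real.exp (-x)) / x) / x)) / x) / ((1 - Real.exp (-x)) / x)
      ≤ 1 / (1 - Real.exp (-2)) := by
  have ha : 0 < 1 - Real.exp (-x) := sub_pos.mpr (Real.exp_lt_one_iff.mpr (by linarith))
  have hE : 0 < 1 - Real.exp (-2) := sub_pos.mpr (Real.exp_lt_one_iff.mpr (by norm_num))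
  have hone : (1 : ℝ) ≤ 1 / (1 - Real.exp (-2)) := by
    rw [le_div_iff₀ hE]
    linarith [Real.exp_pos (-2)]
  refine le_trans ?_ hone
  rw [div_div_div_cancel_right₀ hx.ne', div_le_one ha]
  have hform : 1 - 2 * ((1 - (1 - Real.exp (-x)) / x) / x)
      = (x ^ 2 - 2 * x + 2 * (1 - Real.exp (-x))) / x ^ 2 := by
    field_simp
    ring
  rw [hform, div_le_iff₀ (by positivity)]
  linarith [exp_neg_mul_two_sub_sq_ge hx]
end

section
/- Define the map β : ℝ² → ℝ² by β(v) = v/(1 + |v|²), where |v| denotes the Euclidean norm on ℝ². Then for all v, w ∈ ℝ², |β(v) − β(w)| ≤ |v − w|; that is, β is 1-Lipschitz with respect to the Euclidean norm. -/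
/-- The scalar inequality behind `beta_lipschitz`, with `s`, `t` the norms of two vectors and `c`
their inner product. -/
lemma beta_sq_dist_le {s t c : ℝ} (hs : 0 ≤ s) (ht : 0 ≤ t) (hc : c ≤ s * t) :
    ((1 + s ^ 2)⁻¹ * s) ^ 2 - 2 * ((1 + s ^ 2)⁻¹ * ((1 + t ^ 2)⁻¹ * c))
      + ((1 + t ^ 2)⁻¹ * t) ^ 2 ≤ s ^ 2 - 2 * c + t ^ 2 := by
  have hst : 0 ≤ s * t := mul_nonneg hs ht
  have hP : 1 + s * t ≤ (1 + s ^ 2) * (1 + t ^ 2) := by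
    nlinarith [sq_nonneg (s - t), sq_nonneg (s * t)]
  have h₁ : 0 ≤ ((1 + s ^ 2) * (1 + t ^ 2)) ^ 2 - (1 - s * t) ^ 2 := by nlinarith
  have h₂ : 0 ≤ ((1 + s ^ 2) * (1 + t ^ 2)) ^ 2 - (1 + s ^ 2) * (1 + t ^ 2) := by nlinarith
  have key : s ^ 2 - 2 * c + t ^ 2 - (((1 + s ^ 2)⁻¹ * s) ^ 2
      - 2 * ((1 + s ^ 2)⁻¹ * ((1 + t ^ 2)⁻¹ * c)) + ((1 + t ^ 2)⁻¹ * t) ^ 2)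
      = ((s - t) ^ 2 * (((1 + s ^ 2) * (1 + t ^ 2)) ^ 2 - (1 - s * t) ^ 2)
        + 2 * (s * t - c) * (((1 + s ^ 2) * (1 + t ^ 2)) ^ 2 - (1 + s ^ 2) * (1 + t ^ 2)))
        / ((1 + s ^ 2) * (1 + t ^ 2)) ^ 2 := by
    have : 1 + s ^ 2 ≠ 0 := by positivity
    have : 1 + t ^ 2 ≠ 0 := by positivity
    field_simp
    ring
  have hc' : 0 ≤ s * t - c := sub_nonneg.mpr hc
  rw [← sub_nonneg, key]
  positivity

/-- The map `β(v) = v/(1 + |v|²)` on the Euclidean plane is 1-Lipschitz: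
`|β(v) - β(w)| ≤ |v - w|` for all `v, w ∈ ℝ²`. -/
theorem beta_lipschitz (v w : EuclideanSpace ℝ (Fin 2)) :
    ‖(1 + ‖v‖ ^ 2)⁻¹ • v - (1 + ‖w‖ ^ 2)⁻¹ • w‖ ≤ ‖v - w‖ := by
  refine (sq_le_sq₀ (norm_nonneg _) (norm_nonneg _)).mp ?_
  have hv : 0 ≤ (1 + ‖v‖ ^ 2)⁻¹ := by positivity
  have hw : 0 ≤ (1 + ‖w‖ ^ 2)⁻¹ := by positivity
  rw [norm_sub_sq_real, norm_sub_sq_real, real_inner_smul_left, real_inner_smul_right,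
    norm_smul_of_nonneg hv, norm_smul_of_nonneg hw]
  exact beta_sq_dist_le (norm_nonneg v) (norm_nonneg w) (real_inner_le_norm v w)
end

section
/- Let κ₀ ∈ ℝ and define H : ℝ² → ℝ by H(a, b) = (1/2)·ln(1 + a² + b²) + (κ₀/2)·(a² + b²). Then H is convex on all of ℝ² if and only if κ₀ ≥ 1/8. -/
/-- The radial profile of `H`, as a function on the whole line. -/
noncomputable def radialProfile (κ₀ x : ℝ) : ℝ :=
  (1 / 2) * Real.log (1 + x ^ 2) + (κ₀ / 2) * x ^ 2

theorem hasDerivAt_radialProfile (κ₀ x : ℝ) :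
    HasDerivAt (radialProfile κ₀) (x / (1 + x ^ 2) + κ₀ * x) x := by
  have hx : 1 + x ^ 2 ≠ 0 := by positivity
  have hsq : HasDerivAt (fun y : ℝ => y ^ 2) (2 * x) x := by
    simpa using hasDerivAt_pow 2 x
  have hlog := ((hsq.const_add 1).log hx).const_mul (1 / 2)
  refine (hlog.add (hsq.const_mul (κ₀ / 2))).congr_deriv ?_
  field_simp

theorem deriv_radialProfile (κ₀ : ℝ) :
    deriv (radialProfile κ₀) = fun x => x / (1 + x ^ 2) + κ₀ * x :=
  funext fun x => (hasDerivAt_radialProfile κ₀ x).deriv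

theorem convexOn_radialProfile {κ₀ : ℝ} (hκ : 1 / 8 ≤ κ₀) :
    ConvexOn ℝ Set.univ (radialProfile κ₀) := by
  refine Monotone.convexOn_univ_of_deriv
    (fun x => (hasDerivAt_radialProfile κ₀ x).differentiableAt) ?_
  rw [deriv_radialProfile]
  intro x y hxy
  have hdiff : (y / (1 + y ^ 2) + κ₀ * y) - (x / (1 + x ^ 2) + κ₀ * x)
      = (y - x) * ((1 - x * y + κ₀ * ((1 + x ^ 2) * (1 + y ^ 2)))
        / ((1 + x ^ 2) * (1 + y ^ 2))) := by
    field_simp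
    ring
  have hnum : 0 ≤ 1 - x * y + κ₀ * ((1 + x ^ 2) * (1 + y ^ 2)) := by
    have hpos : 0 ≤ (1 + x ^ 2) * (1 + y ^ 2) := by positivity
    nlinarith [mul_le_mul_of_nonneg_right hκ hpos, sq_nonneg (x * y - 3), sq_nonneg (x - y)]
  have := mul_nonneg (sub_nonneg.2 hxy)
    (div_nonneg hnum (by positivity : 0 ≤ (1 + x ^ 2) * (1 + y ^ 2)))
  exact sub_nonneg.1 (hdiff ▸ this)

theorem radialProfile_le {κ₀ x y : ℝ} (hκ : 0 ≤ κ₀) (hx : 0 ≤ x) (hxy : x ≤ y) :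
    radialProfile κ₀ x ≤ radialProfile κ₀ y := by
  unfold radialProfile
  gcongr

theorem le_of_convexOn_radialProfile {κ₀ : ℝ}
    (h : ConvexOn ℝ Set.univ (radialProfile κ₀)) : 1 / 8 ≤ κ₀ := by
  have hmono : Monotone (deriv (radialProfile κ₀)) := monotoneOn_univ.1 <|
    h.monotoneOn_deriv fun x _ => (hasDerivAt_radialProfile κ₀ x).differentiableAt
  rw [deriv_radialProfile] at hmono
  have h3 : √3 ^ 2 = (3 : ℝ) := Real.sq_sqrt (by norm_num)
  have hsq : HasDerivAt (fun y : ℝ => y ^ 2) (2 * √3) √3 := by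
    simpa using hasDerivAt_pow 2 √3
  have hd : HasDerivAt (fun x : ℝ => x / (1 + x ^ 2) + κ₀ * x) (κ₀ - 1 / 8) √3 := by
    refine (((hasDerivAt_id √3).div (hsq.const_add 1) (by positivity)).add
      ((hasDerivAt_id √3).const_mul κ₀)).congr_deriv ?_
    simp only [id, h3]
    linear_combination (-1 / 8) * h3
  have := hmono.deriv_nonneg (x := √3)
  rw [hd.deriv] at this
  linarith

theorem radialProfile_norm_equivRealProd_symm (κ₀ : ℝ) (p : ℝ × ℝ) :
    radialProfile κ₀ ‖Complex.equivRealProdCLM.symm p‖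
      = (1 / 2) * Real.log (1 + p.1 ^ 2 + p.2 ^ 2) + (κ₀ / 2) * (p.1 ^ 2 + p.2 ^ 2) := by
  have hp : ‖Complex.equivRealProdCLM.symm p‖ ^ 2 = p.1 ^ 2 + p.2 ^ 2 := by
    rw [Complex.sq_norm, Complex.normSq_apply]
    simp [sq]
  rw [radialProfile, hp, add_assoc]

/-- `H(a,b) = (1/2)·ln(1 + a² + b²) + (κ₀/2)·(a² + b²)` is convex on all of `ℝ²`
if and only if `κ₀ ≥ 1/8`. -/
theorem convexOn_H_iff (κ₀ : ℝ) :
    ConvexOn ℝ Set.univ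
      (fun p : ℝ × ℝ =>
        (1 / 2) * Real.log (1 + p.1 ^ 2 + p.2 ^ 2) + (κ₀ / 2) * (p.1 ^ 2 + p.2 ^ 2))
      ↔ κ₀ ≥ 1 / 8 := by
  constructor
  · intro h
    apply le_of_convexOn_radialProfile
    have hline := h.comp_linearMap (LinearMap.inl ℝ ℝ ℝ)
    rw [Set.preimage_univ] at hline
    refine hline.congr fun x _ => ?_
    simp [radialProfile]
  · intro hκ
    simp_rw [← radialProfile_norm_equivRealProd_symm]
    refine ⟨convex_univ, fun p _ q _ a b ha hb hab => ?_⟩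
    have hnorm : ‖Complex.equivRealProdCLM.symm (a • p + b • q)‖
        ≤ a • ‖Complex.equivRealProdCLM.symm p‖ + b • ‖Complex.equivRealProdCLM.symm q‖ := by
      rw [map_add, map_smul, map_smul]
      exact convexOn_univ_norm.2 trivial trivial ha hb hab
    exact (radialProfile_le (by linarith) (norm_nonneg _) hnorm).trans
      ((convexOn_radialProfile hκ).2 trivial trivial ha hb hab)
end

section
/- Let κ ≥ 1/4 and set κ* = κ − 1/8, γ⁽⁰⁾ = 3(1 + κ)/(1 − e^{−2}), and α₀ = ln((γ⁽⁰⁾ + κ/2)/(γ⁽⁰⁾ − κ/2)). Let ε > 0 and Δt > 0, and suppose A ≥ (γ⁽⁰⁾ − κ/4)⁴ · α₀^{−2} · ε^{−2}. Then for every λ > 0, writing Λ = ε²λ² + κλ, the following inequality holds: Λ·e^{−Δt·Λ}/(1 − e^{−Δt·Λ}) + (ε²/2 + A·Δt²)·λ² + κ*·λ ≥ γ⁽⁰⁾·λ. -/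
/-- The lower bound `coth (s / 2) ≥ 2 / s` for `s > 0`, written in terms of `exp (-s)`. -/
lemma inv_le_exp_neg_div_one_sub_exp_neg_add_half {s : ℝ} (hs : 0 < s) :
    1 / s ≤ Real.exp (-s) / (1 - Real.exp (-s)) + 1 / 2 := by
  have h1 : 1 < Real.exp s := Real.one_lt_exp_iff.2 hs
  have h := Real.le_log_one_add_of_nonneg (x := Real.exp s - 1) (by linarith)
  rw [add_sub_cancel, Real.log_exp, div_le_iff₀ (by linarith)] at h
  have key : Real.exp (-s) / (1 - Real.exp (-s)) = 1 / (Real.exp s - 1) := by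
    have : Real.exp s - 1 ≠ 0 := by linarith
    rw [Real.exp_neg]
    field_simp
  rw [key, div_add_div _ _ (by linarith) two_ne_zero, div_le_div_iff₀ hs (by linarith)]
  linarith

/-- Per-Fourier-mode form of the key eigenvalue estimate underlying the energy
stability of the third order ETD scheme for the no-slope-selection equation.
With `κ ≥ 1/4`, `κ* = κ - 1/8`, `γ⁽⁰⁾ = 3(1 + κ)/(1 - e^{-2})`,
`α₀ = ln((γ⁽⁰⁾ + κ/2)/(γ⁽⁰⁾ - κ/2))`, `ε > 0`, `Δt > 0`, and
`A ≥ (γ⁽⁰⁾ - κ/4)⁴ · α₀⁻² · ε⁻²`, for every `λ > 0`, with `Λ = ε²λ² + κλ`, one has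
`Λ·e^{-ΔtΛ}/(1 - e^{-ΔtΛ}) + (ε²/2 + A·Δt²)·λ² + κ*·λ ≥ γ⁽⁰⁾·λ`. -/
theorem mode_energy_estimate (κ κs γ α₀ ε Δt A : ℝ)
    (hκ : 1 / 4 ≤ κ)
    (hκs : κs = κ - 1 / 8)
    (hγ : γ = 3 * (1 + κ) / (1 - Real.exp (-2)))
    (hα₀ : α₀ = Real.log ((γ + κ / 2) / (γ - κ / 2)))
    (hε : 0 < ε) (hΔt : 0 < Δt)
    (hA : (γ - κ / 4) ^ 4 * (α₀ ^ 2)⁻¹ * (ε ^ 2)⁻¹ ≤ A) :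
    ∀ lam : ℝ, 0 < lam →
      γ * lam ≤
        (ε ^ 2 * lam ^ 2 + κ * lam) *
            Real.exp (-(Δt * (ε ^ 2 * lam ^ 2 + κ * lam))) /
            (1 - Real.exp (-(Δt * (ε ^ 2 * lam ^ 2 + κ * lam)))) +
          (ε ^ 2 / 2 + A * Δt ^ 2) * lam ^ 2 + κs * lam := by
  intro lam hlam
  have hexp0 : 0 < Real.exp (-2) := Real.exp_pos _
  have hexp1 : Real.exp (-2) < 1 := Real.exp_lt_one_iff.2 (by norm_num)
  have hγκ : 3 * κ ≤ γ := by
    rw [hγ, le_div_iff₀ (by linarith)]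
    nlinarith
  have hαpos : 0 < α₀ := by
    rw [hα₀]
    apply Real.log_pos
    rw [one_lt_div (by linarith)]
    linarith
  have hαγ : α₀ * γ ≤ 2 * κ := by
    have h := Real.log_le_sub_one_of_pos
      (x := (γ + κ / 2) / (γ - κ / 2)) (div_pos (by linarith) (by linarith))
    rw [← hα₀, div_sub_one (by linarith), le_div_iff₀ (by linarith)] at h
    nlinarith
  obtain ⟨G, hG⟩ : ∃ G, G = γ - κ / 4 := ⟨_, rfl⟩
  rw [← hG] at hA
  have hA0 : 0 ≤ A := le_trans (by positivity) hA
  obtain ⟨Λ, hΛ⟩ : ∃ Λ, Λ = ε ^ 2 * lam ^ 2 + κ * lam := ⟨_, rfl⟩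
  rw [← hΛ]
  have hκpos : 0 < κ := by linarith
  have hΛpos : 0 < Λ := by rw [hΛ]; positivity
  have hs : 0 < Δt * Λ := by positivity
  have hE : Real.exp (-(Δt * Λ)) < 1 := Real.exp_lt_one_iff.2 (by linarith)
  have hκs' : κ / 2 * lam ≤ κs * lam := by
    rw [hκs]
    gcongr
    linarith
  rw [mul_div_assoc]
  rcases le_or_gt (γ * lam * Δt) 1 with hsmall | hlarge
  · have hcoth := mul_le_mul_of_nonneg_left
      (inv_le_exp_neg_div_one_sub_exp_neg_add_half hs) hΛpos.le
    have hinv : Λ * (1 / (Δt * Λ)) = 1 / Δt := by field_simp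
    have hγlam : γ * lam ≤ 1 / Δt := (le_div_iff₀ hΔt).2 hsmall
    have : 0 ≤ A * Δt ^ 2 * lam ^ 2 := by positivity
    rw [hinv] at hcoth
    linarith
  · have hT : 0 ≤ Λ * (Real.exp (-(Δt * Λ)) / (1 - Real.exp (-(Δt * Λ)))) :=
      mul_nonneg hΛpos.le (div_nonneg (Real.exp_pos _).le (by linarith))
    have hA' : G ^ 4 ≤ A * ε ^ 2 * α₀ ^ 2 := by
      rwa [← div_eq_mul_inv, ← div_eq_mul_inv, div_le_iff₀ (by positivity),
        div_le_iff₀ (by positivity)] at hA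
    have hGκ : 2 * κ ≤ G := by linarith
    have hGpos : 0 < G := by linarith
    have hα : α₀ ≤ G * (lam * Δt) := by
      have : α₀ * 1 ≤ α₀ * (γ * lam * Δt) := by gcongr
      have : α₀ * γ * (lam * Δt) ≤ G * (lam * Δt) := by
        gcongr
        linarith
      linarith
    have hP : G ^ 2 ≤ A * Δt ^ 2 * lam ^ 2 * ε ^ 2 := by
      have h : G ^ 4 ≤ A * ε ^ 2 * (G * (lam * Δt)) ^ 2 := hA'.trans (by gcongr)
      refine le_of_mul_le_mul_right ?_ (pow_pos hGpos 2)
      linarith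
    have hmain : G * lam ≤ ε ^ 2 / 2 * lam ^ 2 + A * Δt ^ 2 * lam ^ 2 := by
      refine le_of_mul_le_mul_right ?_ (pow_pos hε 2)
      nlinarith [sq_nonneg (ε ^ 2 * lam - G), sq_nonneg G]
    have : 0 < κ * lam := by positivity
    rw [show γ = G + κ / 4 by linarith]
    linarith
end
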